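/- Let V_σ(x) = exp(σ^{-1}·min(|x−1|, |x+1|)). There exist constants 0 < α ≤ 1, 0 ≤ M, C < ∞ and σ₀ > 0 such that for all 0 < σ < σ₀ and all x ∈ (−∞, −Mσ): (K_σ V_σ)(x) = ∫ V_σ(y) K_σ(x, dy) ≤ (1−α)·V_σ(x) + C. -/

import Mathlib

open MeasureTheory Filter Set

/-- Gaussian density `φ_σ` with mean 0 and variance `σ²`. -/
noncomputable def gaussDensity (σ x : ℝ) : ℝ :=
  (Real.sqrt (2 * Real.pi * σ ^ 2))⁻¹ * Real.exp (-(x ^ 2) / (2 * σ ^ 2))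

/-- Density `f_σ` of the mixture `½ N(-1,σ²) + ½ N(1,σ²)`. -/
noncomputable def mixDensity (σ x : ℝ) : ℝ :=
  (1 / 2) * gaussDensity σ (x + 1) + (1 / 2) * gaussDensity σ (x - 1)

/-- The `N(0,σ²)` measure, defined via its density `φ_σ` w.r.t. Lebesgue measure. -/
noncomputable def gaussMeasure (σ : ℝ) : Measure ℝ :=
  volume.withDensity fun z => ENNReal.ofReal (gaussDensity σ z)

/-- The random-walk Metropolis kernel `K_σ(x, ·)` as a measure: the accepted-move part
has density `min(1, f_σ(y)/f_σ(x))` w.r.t. the proposal `x + N(0,σ²)`, and the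
remaining mass `1 − ∫ min(1, f_σ(x+z)/f_σ(x)) φ_σ(z) dz` stays at `x`. -/
noncomputable def rwmKernel (σ : ℝ) (x : ℝ) : Measure ℝ :=
  ((gaussMeasure σ).map (fun z => x + z)).withDensity
      (fun y => ENNReal.ofReal (min 1 (mixDensity σ y / mixDensity σ x)))
  + (ENNReal.ofReal
      (1 - ∫ z, min 1 (mixDensity σ (x + z) / mixDensity σ x) * gaussDensity σ z))
      • Measure.dirac x

/-- The restricted Metropolis–Hastings kernel `K̂_σ` on `(-∞,0)`:
`K̂_σ(x,A) = K_σ(x, A ∩ (-∞,0)) + 1_A(x) K_σ(x,[0,∞))`. -/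
noncomputable def rwmKernelHat (σ : ℝ) (x : ℝ) : Measure ℝ :=
  (rwmKernel σ x).restrict (Set.Iio 0) + (rwmKernel σ x (Set.Ici 0)) • Measure.dirac x

/-- The Lyapunov function `V_σ(x) = exp(σ⁻¹ min(|x-1|,|x+1|))`. -/
noncomputable def lyapV (σ x : ℝ) : ℝ := Real.exp (σ⁻¹ * min |x - 1| |x + 1|)

/-- The rescaled distance `σ⁻¹ min(|x-1|,|x+1|)` to the nearest mode. -/
noncomputable def modeDist (σ x : ℝ) : ℝ := σ⁻¹ * min |x - 1| |x + 1|

lemma lyapV_eq_exp_modeDist (σ x : ℝ) : lyapV σ x = Real.exp (modeDist σ x) := rfl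

lemma continuous_gaussDensity (σ : ℝ) : Continuous (gaussDensity σ) := by
  unfold gaussDensity
  fun_prop

lemma continuous_mixDensity (σ : ℝ) : Continuous (mixDensity σ) := by
  have := continuous_gaussDensity σ
  unfold mixDensity
  fun_prop

lemma gaussDensity_pos {σ : ℝ} (hσ : 0 < σ) (x : ℝ) : 0 < gaussDensity σ x := by
  unfold gaussDensity
  positivity

lemma mixDensity_pos {σ : ℝ} (hσ : 0 < σ) (x : ℝ) : 0 < mixDensity σ x := by
  have h₁ := gaussDensity_pos hσ (x + 1)
  have h₂ := gaussDensity_pos hσ (x - 1)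
  unfold mixDensity
  positivity

lemma gaussDensity_eq {σ : ℝ} (hσ : 0 < σ) (x : ℝ) :
    gaussDensity σ x = gaussDensity σ 0 * Real.exp (-(σ⁻¹ * |x|) ^ 2 / 2) := by
  unfold gaussDensity
  have : -(σ⁻¹ * |x|) ^ 2 / 2 = -(x ^ 2) / (2 * σ ^ 2) := by
    rw [mul_pow, sq_abs]
    field_simp
  rw [this]
  simp

lemma mixDensity_bounds {σ : ℝ} (hσ : 0 < σ) (x : ℝ) :
    gaussDensity σ 0 * Real.exp (-(modeDist σ x) ^ 2 / 2) / 2 ≤ mixDensity σ x ∧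
      mixDensity σ x ≤ gaussDensity σ 0 * Real.exp (-(modeDist σ x) ^ 2 / 2) := by
  have h₀ := gaussDensity_pos hσ 0
  have key : ∀ a b : ℝ, 0 ≤ a → a ≤ b → gaussDensity σ 0 * Real.exp (-(σ⁻¹ * b) ^ 2 / 2) ≤
      gaussDensity σ 0 * Real.exp (-(σ⁻¹ * a) ^ 2 / 2) := by
    intro a b ha hab
    have : (σ⁻¹ * a) ^ 2 ≤ (σ⁻¹ * b) ^ 2 := by gcongr
    gcongr
  have h₁ := gaussDensity_pos hσ (x + 1)
  have h₂ := gaussDensity_pos hσ (x - 1)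
  unfold mixDensity modeDist
  rcases le_total |x - 1| |x + 1| with h | h
  · rw [min_eq_left h, ← gaussDensity_eq hσ]
    have := key _ _ (abs_nonneg _) h
    rw [← gaussDensity_eq hσ, ← gaussDensity_eq hσ] at this
    constructor <;> linarith
  · rw [min_eq_right h, ← gaussDensity_eq hσ]
    have := key _ _ (abs_nonneg _) h
    rw [← gaussDensity_eq hσ, ← gaussDensity_eq hσ] at this
    constructor <;> linarith

lemma mixDensity_ratio_le {σ : ℝ} (hσ : 0 < σ) (x y : ℝ) :
    mixDensity σ y / mixDensity σ x ≤
      2 * Real.exp (-(modeDist σ y ^ 2 - modeDist σ x ^ 2) / 2) := by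
  rw [div_le_iff₀ (mixDensity_pos hσ x)]
  refine (mixDensity_bounds hσ y).2.trans ?_
  refine le_trans (le_of_eq ?_) (mul_le_mul_of_nonneg_left (mixDensity_bounds hσ x).1 (by positivity))
  have : Real.exp (-(modeDist σ y) ^ 2 / 2) =
      Real.exp (-(modeDist σ y ^ 2 - modeDist σ x ^ 2) / 2) *
        Real.exp (-(modeDist σ x) ^ 2 / 2) := by
    rw [← Real.exp_add]
    ring_nf
  rw [this]
  ring

lemma half_le_mixDensity_ratio {σ : ℝ} (hσ : 0 < σ) {x y : ℝ} (hy : 0 ≤ modeDist σ y)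
    (h : modeDist σ y ≤ modeDist σ x) : 1 / 2 ≤ mixDensity σ y / mixDensity σ x := by
  rw [le_div_iff₀ (mixDensity_pos hσ x)]
  have h₀ := gaussDensity_pos hσ 0
  have h₁ : modeDist σ y ^ 2 ≤ modeDist σ x ^ 2 := by gcongr
  have h₂ : gaussDensity σ 0 * Real.exp (-(modeDist σ x) ^ 2 / 2) ≤
      gaussDensity σ 0 * Real.exp (-(modeDist σ y) ^ 2 / 2) := by gcongr
  linarith [(mixDensity_bounds hσ x).2, (mixDensity_bounds hσ y).1]

lemma modeDist_nonneg {σ : ℝ} (hσ : 0 < σ) (x : ℝ) : 0 ≤ modeDist σ x := by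
  unfold modeDist
  positivity

/-- The Metropolis acceptance probability of a move from `x` to `y`. -/
noncomputable def acceptProb (σ x y : ℝ) : ℝ := min 1 (mixDensity σ y / mixDensity σ x)

lemma continuous_acceptProb (σ x : ℝ) : Continuous (acceptProb σ x) := by
  have := continuous_mixDensity σ
  unfold acceptProb
  fun_prop

lemma acceptProb_nonneg {σ : ℝ} (hσ : 0 < σ) (x y : ℝ) : 0 ≤ acceptProb σ x y :=
  le_min zero_le_one (div_pos (mixDensity_pos hσ y) (mixDensity_pos hσ x)).le

lemma acceptProb_le_one (σ x y : ℝ) : acceptProb σ x y ≤ 1 := min_le_left _ _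

lemma gaussMeasure_eq_gaussianReal {σ : ℝ} (hσ : 0 < σ) :
    gaussMeasure σ = ProbabilityTheory.gaussianReal 0 (σ ^ 2).toNNReal := by
  rw [ProbabilityTheory.gaussianReal_of_var_ne_zero]
  · unfold gaussMeasure
    congr 1
    ext z
    simp [ProbabilityTheory.gaussianPDF, ProbabilityTheory.gaussianPDFReal, gaussDensity,
      Real.coe_toNNReal _ (sq_nonneg σ)]
  · exact (Real.toNNReal_pos.2 (by positivity)).ne'

lemma isProbabilityMeasure_gaussMeasure {σ : ℝ} (hσ : 0 < σ) :
    IsProbabilityMeasure (gaussMeasure σ) := by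
  rw [gaussMeasure_eq_gaussianReal hσ]
  infer_instance

lemma integral_gaussMeasure {σ : ℝ} (hσ : 0 < σ) (g : ℝ → ℝ) :
    ∫ z, g z ∂gaussMeasure σ = ∫ z, g z * gaussDensity σ z := by
  unfold gaussMeasure
  rw [integral_withDensity_eq_integral_toReal_smul
    (continuous_gaussDensity σ).measurable.ennreal_ofReal (by simp)]
  refine integral_congr_ae (ae_of_all _ fun z => ?_)
  simp [ENNReal.toReal_ofReal (gaussDensity_pos hσ z).le, mul_comm]

/-- An interval of length `σ` within distance `2σ` of the origin has Gaussian mass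
bounded below independently of `σ`. -/
lemma gaussMeasure_real_Icc_ge {σ a : ℝ} (hσ : 0 < σ) (ha : -(2 * σ) ≤ a) (hb : a ≤ σ) :
    (Real.sqrt (2 * Real.pi))⁻¹ * Real.exp (-2) ≤ (gaussMeasure σ).real (Icc a (a + σ)) := by
  have := isProbabilityMeasure_gaussMeasure hσ
  have hc : ∀ z ∈ Icc a (a + σ), (Real.sqrt (2 * Real.pi))⁻¹ * Real.exp (-2) * σ⁻¹ ≤
      gaussDensity σ z := by
    intro z hz
    have hz2 : z ^ 2 ≤ (2 * σ) ^ 2 := sq_le_sq' (by linarith [hz.1]) (by linarith [hz.2])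
    unfold gaussDensity
    rw [Real.sqrt_mul (by positivity : 0 ≤ 2 * Real.pi), Real.sqrt_sq hσ.le, mul_inv, mul_right_comm]
    gcongr
    rw [le_div_iff₀ (by positivity)]
    nlinarith
  refine (ENNReal.ofReal_le_iff_le_toReal (measure_ne_top _ _)).1 ?_
  unfold gaussMeasure
  rw [withDensity_apply _ measurableSet_Icc]
  refine le_trans (le_of_eq ?_) (setLIntegral_mono
    (f := fun _ => ENNReal.ofReal ((Real.sqrt (2 * Real.pi))⁻¹ * Real.exp (-2) * σ⁻¹))
    (continuous_gaussDensity σ).measurable.ennreal_ofReal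
    fun z hz => ENNReal.ofReal_le_ofReal (hc z hz))
  rw [setLIntegral_const, Real.volume_Icc, ← ENNReal.ofReal_mul (by positivity)]
  congr 1
  field_simp
  ring

lemma rwmKernel_eq {σ : ℝ} (hσ : 0 < σ) (x : ℝ) :
    rwmKernel σ x = ((gaussMeasure σ).map (fun z => x + z)).withDensity
        (fun y => ENNReal.ofReal (acceptProb σ x y)) +
      ENNReal.ofReal (1 - ∫ z, acceptProb σ x (x + z) ∂gaussMeasure σ) • Measure.dirac x := by
  rw [integral_gaussMeasure hσ]
  rfl

/-- A pointwise bound on the accepted increments of `V_σ` which improves by `L` on a set `S`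
of proposals gives a bound on `K_σ V_σ`. -/
lemma integral_rwmKernel_le {σ : ℝ} (hσ : 0 < σ) (x B L : ℝ) (S : Set ℝ)
    (hS : MeasurableSet S) (hB : 0 ≤ lyapV σ x + B - L * (gaussMeasure σ).real S)
    (h : ∀ z, acceptProb σ x (x + z) * (lyapV σ (x + z) - lyapV σ x) ≤
      B - S.indicator (fun _ => L) z) :
    ∫ y, lyapV σ y ∂(rwmKernel σ x) ≤ lyapV σ x + B - L * (gaussMeasure σ).real S := by
  have := isProbabilityMeasure_gaussMeasure hσ
  by_cases hint : Integrable (lyapV σ) (rwmKernel σ x)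
  swap
  · rwa [integral_undef hint]
  rw [rwmKernel_eq hσ] at hint ⊢
  have hacc : Measurable fun y => ENNReal.ofReal (acceptProb σ x y) :=
    (continuous_acceptProb σ x).measurable.ennreal_ofReal
  have hemb : MeasurableEmbedding fun z : ℝ => x + z := measurableEmbedding_addLeft x
  have hA := hint.left_of_add_measure
  have hD := hint.right_of_add_measure
  have hq : Integrable (fun z => acceptProb σ x (x + z)) (gaussMeasure σ) := by
    refine Integrable.of_bound (C := 1) ?_ (ae_of_all _ fun z => ?_)
    · exact ((continuous_acceptProb σ x).comp (by fun_prop)).aestronglyMeasurable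
    · rw [Real.norm_of_nonneg (acceptProb_nonneg hσ _ _)]
      exact acceptProb_le_one _ _ _
  have hq1 : ∫ z, acceptProb σ x (x + z) ∂gaussMeasure σ ≤ 1 := by
    refine (integral_mono hq (integrable_const 1) fun z => acceptProb_le_one _ _ _).trans ?_
    simp
  have hAV : Integrable (fun z => acceptProb σ x (x + z) * lyapV σ (x + z)) (gaussMeasure σ) := by
    have h₁ := (integrable_withDensity_iff_integrable_smul' hacc (by simp)).1 hA
    have h₂ := (hemb.integrable_map_iff).1 h₁
    refine h₂.congr (ae_of_all _ fun z => ?_)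
    simp [ENNReal.toReal_ofReal (acceptProb_nonneg hσ x (x + z))]
  have e₂ : ∫ z, (ENNReal.ofReal (acceptProb σ x (x + z))).toReal • lyapV σ (x + z)
      ∂gaussMeasure σ = ∫ z, acceptProb σ x (x + z) * lyapV σ (x + z) ∂gaussMeasure σ := by
    simp only [ENNReal.toReal_ofReal (acceptProb_nonneg hσ x _), smul_eq_mul]
  have e₃ : ∫ z, acceptProb σ x (x + z) * (lyapV σ (x + z) - lyapV σ x) ∂gaussMeasure σ =
      ∫ z, acceptProb σ x (x + z) * lyapV σ (x + z) ∂gaussMeasure σ -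
        (∫ z, acceptProb σ x (x + z) ∂gaussMeasure σ) * lyapV σ x := by
    rw [← integral_mul_const, ← integral_sub hAV (hq.mul_const _)]
    simp only [mul_sub]
  have hind : Integrable (S.indicator fun _ => L) (gaussMeasure σ) :=
    (integrable_const L).indicator hS
  have hle : ∫ z, acceptProb σ x (x + z) * (lyapV σ (x + z) - lyapV σ x) ∂gaussMeasure σ ≤
      ∫ z, (B - S.indicator (fun _ => L) z) ∂gaussMeasure σ := by
    refine integral_mono ?_ ((integrable_const B).sub hind) h
    simp only [mul_sub]
    exact hAV.sub (hq.mul_const _)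
  rw [integral_sub (integrable_const B) hind, integral_indicator_const L hS, e₃] at hle
  rw [integral_add_measure hA hD, integral_smul_measure, integral_dirac,
    integral_withDensity_eq_integral_toReal_smul hacc (by simp), hemb.integral_map,
    ENNReal.toReal_ofReal (by linarith), e₂]
  simp only [integral_const, probReal_univ, smul_eq_mul] at hle ⊢
  linarith

/-- Far from the modes, moves away from them contribute little to the drift. -/
lemma acceptProb_mul_lyapV_sub_le {σ ε : ℝ} (hσ : 0 < σ) (hε : 0 < ε) {x : ℝ}
    (hx : 1 + 2 / ε ≤ modeDist σ x) (y : ℝ) :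
    acceptProb σ x y * (lyapV σ y - lyapV σ x) ≤ ε * lyapV σ x := by
  have ha := acceptProb_nonneg hσ x y
  have hV : 0 < lyapV σ x := Real.exp_pos _
  rcases le_total (modeDist σ y) (modeDist σ x) with h | h
  · have : lyapV σ y ≤ lyapV σ x := Real.exp_le_exp.2 h
    nlinarith [mul_nonneg ha (sub_nonneg.2 this), mul_pos hε hV]
  obtain ⟨s, hs⟩ : ∃ s, s = modeDist σ y - modeDist σ x := ⟨_, rfl⟩
  have hs0 : 0 ≤ s := by linarith
  set d := modeDist σ x with hd
  have hε2 : 0 < 2 / ε := by positivity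
  have hy : modeDist σ y = d + s := by linarith
  have hVy : lyapV σ y - lyapV σ x = (Real.exp s - 1) * lyapV σ x := by
    rw [lyapV_eq_exp_modeDist, lyapV_eq_exp_modeDist, hy, Real.exp_add]
    ring
  have hacc : acceptProb σ x y ≤ 2 * Real.exp (-(s * d)) := by
    refine (min_le_right _ _).trans ((mixDensity_ratio_le hσ x y).trans ?_)
    rw [← hd, hy]
    gcongr
    nlinarith [sq_nonneg s]
  have h₁ : Real.exp s - 1 ≤ s * Real.exp s := by
    have := Real.add_one_le_exp (-s)
    have h2 := mul_le_mul_of_nonneg_right this (Real.exp_pos s).le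
    rw [← Real.exp_add, neg_add_cancel, Real.exp_zero] at h2
    linarith
  have h₂ : s * (2 / ε) * Real.exp (-(s * (d - 1))) ≤ 1 := by
    rw [Real.exp_neg, ← div_eq_mul_inv, div_le_one (Real.exp_pos _)]
    have := Real.add_one_le_exp (s * (d - 1))
    nlinarith
  have h₃ : 2 * s * Real.exp (-(s * (d - 1))) ≤ ε := by
    have := mul_le_mul_of_nonneg_left h₂ hε.le
    calc _ = ε * (s * (2 / ε) * Real.exp (-(s * (d - 1)))) := by field_simp
      _ ≤ ε := by linarith
  rw [hVy, ← mul_assoc]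
  gcongr
  calc _ ≤ (2 * Real.exp (-(s * d))) * (s * Real.exp s) := by
        gcongr
        linarith [Real.add_one_le_exp s]
    _ = 2 * s * Real.exp (-(s * (d - 1))) := by
        rw [show -(s * (d - 1)) = -(s * d) + s by ring, Real.exp_add]
        ring
    _ ≤ ε := h₃

lemma acceptProb_mul_lyapV_sub_le_const {σ R : ℝ} (hσ : 0 < σ) {x : ℝ}
    (hx : modeDist σ x ≤ R) (y : ℝ) :
    acceptProb σ x y * (lyapV σ y - lyapV σ x) ≤ 2 * Real.exp (1 / 2 + R ^ 2 / 2) := by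
  have ha := acceptProb_nonneg hσ x y
  have hV : 0 < lyapV σ x := Real.exp_pos _
  have hV' : 0 < lyapV σ y := Real.exp_pos _
  have hd := modeDist_nonneg hσ x
  have hd2 : modeDist σ x ^ 2 ≤ R ^ 2 := by gcongr
  calc _ ≤ acceptProb σ x y * lyapV σ y := by gcongr; linarith
    _ ≤ 2 * Real.exp (-(modeDist σ y ^ 2 - modeDist σ x ^ 2) / 2) * lyapV σ y := by
        gcongr
        exact (min_le_right _ _).trans (mixDensity_ratio_le hσ x y)
    _ = 2 * Real.exp (-(modeDist σ y ^ 2 - modeDist σ x ^ 2) / 2 + modeDist σ y) := by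
        rw [Real.exp_add, lyapV_eq_exp_modeDist, mul_assoc]
    _ ≤ _ := by
        refine mul_le_mul_of_nonneg_left (Real.exp_le_exp.2 ?_) zero_le_two
        nlinarith [sq_nonneg (modeDist σ y - 1)]

/-- Moves that decrease the distance to the nearest mode by at least `1` decrease `V_σ`. -/
lemma acceptProb_mul_lyapV_sub_le_neg {σ : ℝ} (hσ : 0 < σ) {x y : ℝ}
    (h : modeDist σ y ≤ modeDist σ x - 1) :
    acceptProb σ x y * (lyapV σ y - lyapV σ x) ≤ -(lyapV σ x / 4) := by
  have hV : 0 < lyapV σ x := Real.exp_pos _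
  have ha : 1 / 2 ≤ acceptProb σ x y :=
    le_min (by norm_num) (half_le_mixDensity_ratio hσ (modeDist_nonneg hσ y) (by linarith))
  have hy : lyapV σ y ≤ lyapV σ x / 2 := by
    have h₁ : lyapV σ y * Real.exp 1 ≤ lyapV σ x := by
      rw [lyapV_eq_exp_modeDist σ y, lyapV_eq_exp_modeDist σ x, ← Real.exp_add]
      exact Real.exp_le_exp.2 (by linarith)
    have h₂ := Real.add_one_le_exp (1 : ℝ)
    have h₃ : 0 < lyapV σ y := Real.exp_pos _
    nlinarith
  nlinarith

lemma modeDist_of_neg (σ : ℝ) {x : ℝ} (hx : x < 0) : modeDist σ x = σ⁻¹ * |x + 1| := by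
  unfold modeDist
  rw [min_eq_right]
  exact sq_le_sq.1 (by nlinarith)

/-- From a negative state far from the mode `-1`, an interval of proposals of length `σ` moves
towards that mode by at least `σ`. -/
lemma exists_Icc_modeDist_le {σ : ℝ} (hσ : 0 < σ) {x : ℝ} (hx : x < 0)
    (hd : 2 ≤ modeDist σ x) : ∃ a, -(2 * σ) ≤ a ∧ a ≤ σ ∧
      ∀ z ∈ Icc a (a + σ), modeDist σ (x + z) ≤ modeDist σ x - 1 := by
  have hle : ∀ y, modeDist σ y ≤ σ⁻¹ * |y + 1| := fun y =>
    mul_le_mul_of_nonneg_left (min_le_right _ _) (by positivity)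
  rw [modeDist_of_neg σ hx] at hd ⊢
  have hd' : 2 * σ ≤ |x + 1| := by
    rwa [inv_mul_eq_div, le_div_iff₀ hσ] at hd
  have red : ∀ z, |x + z + 1| ≤ |x + 1| - σ → modeDist σ (x + z) ≤ σ⁻¹ * |x + 1| - 1 := by
    intro z hz
    refine (hle _).trans ((mul_le_mul_of_nonneg_left hz (by positivity)).trans (le_of_eq ?_))
    field_simp
  rcases le_total 0 (x + 1) with h | h
  · rw [abs_of_nonneg h] at *
    refine ⟨-(2 * σ), le_rfl, by linarith, fun z hz => red z ?_⟩
    obtain ⟨h₁, h₂⟩ := hz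
    rw [abs_of_nonneg (by linarith)]
    linarith
  · rw [abs_of_nonpos h] at *
    refine ⟨σ, by linarith, le_rfl, fun z hz => red z ?_⟩
    obtain ⟨h₁, h₂⟩ := hz
    rw [abs_of_nonpos (by linarith)]
    linarith

/-- Drift condition for the full random-walk Metropolis kernel `K_σ` on `(-∞, -Mσ)`:
`(K_σ V_σ)(x) ≤ (1-α) V_σ(x) + C`. -/
theorem stmt8 :
    ∃ α M C σ₀ : ℝ, 0 < α ∧ α ≤ 1 ∧ 0 ≤ M ∧ 0 ≤ C ∧ 0 < σ₀ ∧
      ∀ σ : ℝ, 0 < σ → σ < σ₀ → ∀ x : ℝ, x < -(M * σ) →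
        (∫ y, lyapV σ y ∂(rwmKernel σ x)) ≤ (1 - α) * lyapV σ x + C := by
  obtain ⟨p, hp⟩ : ∃ p, p = (Real.sqrt (2 * Real.pi))⁻¹ * Real.exp (-2) := ⟨_, rfl⟩
  have hp0 : 0 < p := by rw [hp]; positivity
  have hp1 : p ≤ 1 := by
    have := isProbabilityMeasure_gaussMeasure one_pos
    rw [hp]
    exact (gaussMeasure_real_Icc_ge (a := 0) one_pos (by norm_num) (by norm_num)).trans
      measureReal_le_one
  obtain ⟨R, hR⟩ : ∃ R, R = 1 + 2 / (p / 8) := ⟨_, rfl⟩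
  have hR2 : 2 ≤ R := by
    have : 1 ≤ 2 / (p / 8) := by rw [le_div_iff₀ (by positivity)]; linarith
    linarith
  refine ⟨p / 8, 0, 2 * Real.exp (1 / 2 + R ^ 2 / 2) + Real.exp R, 1, by positivity, by linarith,
    le_rfl, by positivity, one_pos, fun σ hσ _ x hx => ?_⟩
  have hx0 : x < 0 := by simpa using hx
  have hV : 0 < lyapV σ x := Real.exp_pos _
  have hC : 0 < 2 * Real.exp (1 / 2 + R ^ 2 / 2) := by positivity
  have hE := Real.exp_pos R
  rcases le_total R (modeDist σ x) with h | h
  · obtain ⟨a, ha₁, ha₂, ha⟩ := exists_Icc_modeDist_le hσ hx0 (hR2.trans h)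
    have hmass := gaussMeasure_real_Icc_ge hσ ha₁ ha₂
    rw [← hp] at hmass
    have := isProbabilityMeasure_gaussMeasure hσ
    have hmass1 : (gaussMeasure σ).real (Icc a (a + σ)) ≤ 1 := measureReal_le_one
    refine (integral_rwmKernel_le hσ x (p / 8 * lyapV σ x) (lyapV σ x / 4) (Icc a (a + σ))
      measurableSet_Icc ?_ fun z => ?_).trans ?_
    · nlinarith
    · by_cases hz : z ∈ Icc a (a + σ)
      · rw [indicator_of_mem hz]
        have := acceptProb_mul_lyapV_sub_le_neg hσ (ha z hz)
        nlinarith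
      · rw [indicator_of_notMem hz, sub_zero]
        exact acceptProb_mul_lyapV_sub_le hσ (by positivity) (hR ▸ h) _
    · nlinarith
  · have hVR : lyapV σ x ≤ Real.exp R := Real.exp_le_exp.2 h
    refine (integral_rwmKernel_le hσ x (2 * Real.exp (1 / 2 + R ^ 2 / 2)) 0 ∅ .empty ?_
      fun z => ?_).trans ?_
    · rw [zero_mul]; linarith
    · simpa using acceptProb_mul_lyapV_sub_le_const hσ h (x + z)
    · nlinarith
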